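/- Let G_t be the 2-dimensional heat kernel and define the fractional integral operator on bounded f by (−Δ_H)^{-α/2} f = (1/Γ(α/2)) ∫_0^∞ s^{α/2 − 1} (G_s * f) ds for α ∈ (0,1). Then for f ∈ L^∞(ℝ²;L¹(J)) with ∇_H f ∈ L^∞(ℝ²;L¹(J)) and any μ > 0, one has ‖∇_H(−Δ_H)^{-α/2} f‖_{L^∞(L¹)} ≤ C₄ μ^{(α−1)/2} ‖f‖_{L^∞(L¹)} + C₅ μ^{α/2} ‖∇_H f‖_{L^∞(L¹)}, with constants C₄, C₅ depending only on α; consequently, choosing μ = (‖f‖/‖∇_H f‖)², ‖∇_H(−Δ_H)^{-α/2} f‖_{L^∞(L¹)} ≤ C ‖f‖_{L^∞(L¹)}^{α} ‖∇_H f‖_{L^∞(L¹)}^{1−α}. -/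

import Mathlib

open Real Set MeasureTheory ENNReal

/-- The 2-dimensional Gauss (heat) kernel. -/
noncomputable def heatKernel2 (s : ℝ) (x : Fin 2 → ℝ) : ℝ :=
  (4 * Real.pi * s)⁻¹ * Real.exp (-(x 0 ^ 2 + x 1 ^ 2) / (4 * s))

/-- The `i`-th partial derivative of the 2-d heat kernel. -/
noncomputable def heatKernel2Deriv (i : Fin 2) (s : ℝ) (x : Fin 2 → ℝ) : ℝ :=
  -(x i / (2 * s)) * heatKernel2 s x

/-- The `i`-th component of `∇_H (-Δ_H)^{-α/2} f`, defined via the heat semigroup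
(Bochner formula) and horizontal convolution. -/
noncomputable def gradFracLap (α : ℝ) (i : Fin 2) (f : (Fin 2 → ℝ) → ℝ → ℝ)
    (x' : Fin 2 → ℝ) (z : ℝ) : ℝ :=
  (Real.Gamma (α / 2))⁻¹ *
    ∫ s in Set.Ioi (0 : ℝ), s ^ (α / 2 - 1) *
      ∫ y' : Fin 2 → ℝ, heatKernel2Deriv i s (x' - y') * f y' z

/-- The anisotropic `L^∞(ℝ²;L¹(J))` norm (as an extended real). -/
noncomputable def anisoNorm (z₀ z₁ : ℝ) (g : (Fin 2 → ℝ) → ℝ → ℝ) : ℝ≥0∞ :=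
  essSup (fun x' : Fin 2 → ℝ => ∫⁻ z in Set.Ioo z₀ z₁, (‖g x' z‖₊ : ℝ≥0∞)) volume

lemma hk2_nonneg {s : ℝ} (hs : 0 < s) (x : Fin 2 → ℝ) : 0 ≤ heatKernel2 s x := by
  unfold heatKernel2; positivity

lemma hk2_integral {s : ℝ} (hs : 0 < s) : ∫ x : Fin 2 → ℝ, heatKernel2 s x = 1 := by
  have h : ∀ x : Fin 2 → ℝ, heatKernel2 s x =
      (4 * Real.pi * s)⁻¹ * ∏ i : Fin 2, Real.exp (-(1 / (4 * s)) * (x i) ^ 2) := by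
    intro x
    unfold heatKernel2
    rw [Fin.prod_univ_two, ← Real.exp_add]
    congr 2
    ring
  simp_rw [h]
  rw [integral_const_mul, integral_fintype_prod_volume_eq_prod
    (f := fun (_ : Fin 2) (v : ℝ) => Real.exp (-(1 / (4 * s)) * v ^ 2))]
  rw [Fin.prod_univ_two, integral_gaussian, Real.mul_self_sqrt (by positivity)]
  have := Real.pi_pos
  field_simp

lemma hk2_lintegral {s : ℝ} (hs : 0 < s) (x' : Fin 2 → ℝ) :
    ∫⁻ y : Fin 2 → ℝ, ENNReal.ofReal (heatKernel2 s (x' - y)) = 1 := by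
  rw [lintegral_sub_left_eq_self (fun y => ENNReal.ofReal (heatKernel2 s y)) x']
  rw [← ofReal_integral_eq_lintegral_ofReal, hk2_integral hs, ENNReal.ofReal_one]
  · by_contra h
    have := integral_undef h
    rw [hk2_integral hs] at this
    exact one_ne_zero this
  · exact Filter.Eventually.of_forall (hk2_nonneg hs)

lemma hk2_deriv_bound {s : ℝ} (hs : 0 < s) (i : Fin 2) (x : Fin 2 → ℝ) :
    |heatKernel2Deriv i s x| ≤ 2 * s ^ (-(1/2) : ℝ) * heatKernel2 (2 * s) x := by
  have hr : (s ^ (-(1/2) : ℝ)) = (√s)⁻¹ := by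
    rw [Real.rpow_neg hs.le, Real.sqrt_eq_rpow]
  rw [hr]
  unfold heatKernel2Deriv
  rw [abs_mul, abs_neg, abs_of_nonneg (hk2_nonneg hs x)]
  have hsq : 0 < √s := Real.sqrt_pos.2 hs
  have hss : √s * √s = s := Real.mul_self_sqrt hs.le
  set r := x 0 ^ 2 + x 1 ^ 2 with hrdef
  have hxr : (x i) ^ 2 ≤ r := by
    fin_cases i <;> simp [hrdef] <;> positivity
  have hE : heatKernel2 s x = 2 * Real.exp (-(r / (8 * s))) * heatKernel2 (2 * s) x := by
    unfold heatKernel2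
    rw [← hrdef]
    have : Real.exp (-r / (4 * s)) = Real.exp (-(r / (8 * s))) * Real.exp (-r / (4 * (2 * s))) := by
      rw [← Real.exp_add]; congr 1; field_simp; ring
    rw [this]; field_simp; try ring
  rw [hE, ← mul_assoc]
  apply mul_le_mul_of_nonneg_right _ (hk2_nonneg (by positivity) x)
  have h1 : |x i| / √s ≤ 2 * Real.exp (r / (8 * s)) := by
    have h2 := Real.add_one_le_exp (r / (8 * s))
    have h3 : (|x i| / √s) ^ 2 ≤ r / s := by
      rw [div_pow, sq_abs, sq, sq (√s), hss, ← sq]; gcongr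
    have h4 : r / (8 * s) = r / s / 8 := by field_simp
    nlinarith [sq_nonneg (|x i| / √s - 2)]
  rw [Real.exp_neg, abs_div, abs_of_pos (by positivity : 0 < 2 * s)]
  have he := Real.exp_pos (r / (8 * s))
  rw [div_le_iff₀ hsq] at h1
  rw [show |x i| / (2 * s) * (2 * (Real.exp (r / (8 * s)))⁻¹)
    = |x i| / (s * Real.exp (r / (8 * s))) by field_simp]
  rw [div_le_iff₀ (by positivity)]
  calc |x i| ≤ _ := h1
    _ = _ := by
      have : (√s)⁻¹ * s = √s := by
        rw [inv_mul_eq_div, div_eq_iff hsq.ne', hss]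
      calc _ = 2 * Real.exp (r / (8 * s)) * ((√s)⁻¹ * s) := by rw [this]
        _ = _ := by ring

lemma measurable_hk2 : Measurable (fun p : ℝ × (Fin 2 → ℝ) => heatKernel2 p.1 p.2) := by
  unfold heatKernel2; fun_prop

lemma measurable_hk2Deriv (i : Fin 2) :
    Measurable (fun p : ℝ × (Fin 2 → ℝ) => heatKernel2Deriv i p.1 p.2) := by
  unfold heatKernel2Deriv heatKernel2; fun_prop

lemma hk2_hasDeriv {s : ℝ} (hs : 0 < s) (i : Fin 2) (x' y : Fin 2 → ℝ) :
    HasLineDerivAt ℝ (fun y => heatKernel2 s (x' - y)) (-heatKernel2Deriv i s (x' - y)) y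
      (Pi.single i 1) := by
  unfold HasLineDerivAt heatKernel2Deriv heatKernel2
  have key : ∀ a b : ℝ, HasDerivAt (fun t : ℝ =>
      (4 * Real.pi * s)⁻¹ * Real.exp (-((a - t) ^ 2 + b) / (4 * s)))
      (a / (2 * s) * ((4 * Real.pi * s)⁻¹ * Real.exp (-(a ^ 2 + b) / (4 * s)))) 0 := by
    intro a b
    have h1 : HasDerivAt (fun t : ℝ => -((a - t) ^ 2 + b) / (4 * s)) (a / (2 * s)) 0 := by
      have := (((((hasDerivAt_id (0:ℝ)).const_sub a).pow 2).add_const b).neg).div_const (4 * s)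
      convert! this using 1
      simp; field_simp; ring
    convert! (h1.exp).const_mul (4 * Real.pi * s)⁻¹ using 1
    simp; ring
  fin_cases i
  · convert! key (x' 0 - y 0) ((x' 1 - y 1) ^ 2) using 1
    · ext t; simp; ring_nf; try simp
    · simp
  · convert! key (x' 1 - y 1) ((x' 0 - y 0) ^ 2) using 1
    · ext t; simp; ring_nf; try simp
    · simp; ring_nf; try simp

lemma kernel_fubini {z₀ z₁ : ℝ} (k : (Fin 2 → ℝ) → ℝ≥0∞) (hk : Measurable k)
    (h : (Fin 2 → ℝ) → ℝ → ℝ) (hh : Measurable (Function.uncurry h)) :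
    ∫⁻ z in Set.Ioo z₀ z₁, ∫⁻ y, k y * ‖h y z‖ₑ ≤ (∫⁻ y, k y) * anisoNorm z₀ z₁ h := by
  have hm : Measurable (fun p : (Fin 2 → ℝ) × ℝ => ‖h p.1 p.2‖ₑ) := hh.enorm
  rw [lintegral_lintegral_swap (by
    apply Measurable.aemeasurable
    exact (hk.comp measurable_snd).mul (hm.comp measurable_swap))]
  rw [← lintegral_mul_const _ hk]
  apply lintegral_mono_ae
  filter_upwards [ENNReal.ae_le_essSup (μ := volume)
    (fun x' : Fin 2 → ℝ => ∫⁻ z in Set.Ioo z₀ z₁, (‖h x' z‖₊ : ℝ≥0∞))] with y hy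
  rw [lintegral_const_mul _ (by exact hm.comp (measurable_const.prodMk measurable_id))]
  gcongr
  exact hy

lemma deriv_measurable (f : (Fin 2 → ℝ) → ℝ → ℝ) (L : (Fin 2 → ℝ) → ℝ → ((Fin 2 → ℝ) →L[ℝ] ℝ))
    (hf : Measurable (Function.uncurry f))
    (hL : ∀ (x' : Fin 2 → ℝ) (z : ℝ), HasFDerivAt (fun y' => f y' z) (L x' z) x')
    (v : Fin 2 → ℝ) : Measurable (Function.uncurry (fun x z => L x z v)) := by
  refine measurable_of_tendsto_metrizable' (ι := ℝ) Filter.atTop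
    (f := fun (c : ℝ) (p : (Fin 2 → ℝ) × ℝ) => c • (f (p.1 + c⁻¹ • v) p.2 - f p.1 p.2)) ?_ ?_
  · intro c
    have h1 : Measurable (fun p : (Fin 2 → ℝ) × ℝ => f (p.1 + c⁻¹ • v) p.2) :=
      hf.comp ((measurable_fst.add_const _).prodMk measurable_snd)
    exact (h1.sub hf).const_smul c
  · rw [tendsto_pi_nhds]
    intro p
    exact (hL p.1 p.2).lim_real v

lemma slice_bound1 {z₀ z₁ s : ℝ} (hs : 0 < s) (i : Fin 2) (x' : Fin 2 → ℝ)
    (f : (Fin 2 → ℝ) → ℝ → ℝ) (hf : Measurable (Function.uncurry f)) :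
    ∫⁻ z in Set.Ioo z₀ z₁, ∫⁻ y, ‖heatKernel2Deriv i s (x' - y) * f y z‖ₑ ≤
      ENNReal.ofReal (2 * s ^ (-(1/2) : ℝ)) * anisoNorm z₀ z₁ f := by
  have hm : Measurable (fun y : Fin 2 → ℝ => ‖heatKernel2Deriv i s (x' - y)‖ₑ) :=
    ((measurable_hk2Deriv i).comp (measurable_const.prodMk (measurable_const.sub measurable_id))).enorm
  simp_rw [enorm_mul]
  refine (kernel_fubini _ hm f hf).trans ?_
  gcongr
  have hs2 : 0 < 2 * s := by positivity
  calc ∫⁻ y, ‖heatKernel2Deriv i s (x' - y)‖ₑ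
      ≤ ∫⁻ y, ENNReal.ofReal (2 * s ^ (-(1/2) : ℝ)) *
          ENNReal.ofReal (heatKernel2 (2 * s) (x' - y)) := by
        apply lintegral_mono
        intro y
        dsimp only
        rw [← ENNReal.ofReal_mul (by positivity), ← ofReal_norm]
        exact ENNReal.ofReal_le_ofReal (hk2_deriv_bound hs i _)
    _ = _ := by
        rw [lintegral_const_mul', hk2_lintegral hs2, mul_one]
        exact ENNReal.ofReal_ne_top

lemma slice_bound0 {z₀ z₁ s : ℝ} (hs : 0 < s) (x' : Fin 2 → ℝ)
    (f : (Fin 2 → ℝ) → ℝ → ℝ) (hf : Measurable (Function.uncurry f)) :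
    ∫⁻ z in Set.Ioo z₀ z₁, ∫⁻ y, ‖heatKernel2 s (x' - y) * f y z‖ₑ ≤ anisoNorm z₀ z₁ f := by
  have hm : Measurable (fun y : Fin 2 → ℝ => ‖heatKernel2 s (x' - y)‖ₑ) :=
    (measurable_hk2.comp (measurable_const.prodMk (measurable_const.sub measurable_id))).enorm
  simp_rw [enorm_mul]
  refine (kernel_fubini _ hm f hf).trans ?_
  have : ∫⁻ y, ‖heatKernel2 s (x' - y)‖ₑ = 1 := by
    rw [← hk2_lintegral hs x']
    congr 1; ext y
    rw [Real.enorm_of_nonneg (hk2_nonneg hs _)]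
  rw [this, one_mul]

lemma ae_integrable {z₀ z₁ : ℝ} (k : (Fin 2 → ℝ) → ℝ) (hk : Measurable k)
    (f : (Fin 2 → ℝ) → ℝ → ℝ) (hf : Measurable (Function.uncurry f))
    (h : ∫⁻ z in Set.Ioo z₀ z₁, ∫⁻ y, ‖k y * f y z‖ₑ ≠ ⊤) :
    ∀ᵐ z ∂(volume.restrict (Set.Ioo z₀ z₁)), Integrable (fun y => k y * f y z) := by
  have hm : Measurable (fun p : ℝ × (Fin 2 → ℝ) => ‖k p.2 * f p.2 p.1‖ₑ) :=
    ((hk.comp measurable_snd).mul (hf.comp measurable_swap)).enorm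
  filter_upwards [ae_lt_top hm.lintegral_prod_right' h] with z hz
  refine ⟨?_, hz⟩
  exact (hk.mul (hf.comp (measurable_id.prodMk measurable_const))).aestronglyMeasurable

lemma slice_bound2 {z₀ z₁ s : ℝ} (hs : 0 < s) (i : Fin 2) (x' : Fin 2 → ℝ)
    (f : (Fin 2 → ℝ) → ℝ → ℝ) (L : (Fin 2 → ℝ) → ℝ → ((Fin 2 → ℝ) →L[ℝ] ℝ))
    (hf : Measurable (Function.uncurry f))
    (hL : ∀ (x' : Fin 2 → ℝ) (z : ℝ), HasFDerivAt (fun y' => f y' z) (L x' z) x')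
    (h1 : anisoNorm z₀ z₁ f ≠ ⊤) (h2 : anisoNorm z₀ z₁ (fun x' z => ‖L x' z‖) ≠ ⊤) :
    ∫⁻ z in Set.Ioo z₀ z₁, ‖∫ y, heatKernel2Deriv i s (x' - y) * f y z‖ₑ ≤
      anisoNorm z₀ z₁ (fun x' z => ‖L x' z‖) := by
  set v : Fin 2 → ℝ := Pi.single i 1 with hv
  have hvn : ‖v‖ = 1 := by rw [hv, Pi.norm_single, norm_one]
  have hLm := deriv_measurable f L hf hL v
  have hle : anisoNorm z₀ z₁ (fun x z => L x z v) ≤ anisoNorm z₀ z₁ (fun x' z => ‖L x' z‖) := by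
    refine essSup_mono_ae (Filter.Eventually.of_forall fun x => ?_)
    apply lintegral_mono
    intro z
    simp only [nnnorm_norm, ENNReal.coe_le_coe]
    have := (L x z).le_opNorm v
    rw [hvn, mul_one] at this
    exact this
  have hkm : Measurable (fun y : Fin 2 → ℝ => heatKernel2 s (x' - y)) :=
    (measurable_hk2.comp (measurable_const.prodMk (measurable_const.sub measurable_id)))
  have hdm : Measurable (fun y : Fin 2 → ℝ => heatKernel2Deriv i s (x' - y)) :=
    ((measurable_hk2Deriv i).comp (measurable_const.prodMk (measurable_const.sub measurable_id)))
  have b0 := slice_bound0 (z₀ := z₀) (z₁ := z₁) hs x' f hf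
  have b1 := slice_bound1 (z₀ := z₀) (z₁ := z₁) hs i x' f hf
  have b2 := slice_bound0 (z₀ := z₀) (z₁ := z₁) hs x' _ hLm
  have i0 := ae_integrable _ hkm f hf (ne_top_of_le_ne_top h1 b0)
  have i1 := ae_integrable _ hdm f hf
    (ne_top_of_le_ne_top (ENNReal.mul_ne_top ENNReal.ofReal_ne_top h1) b1)
  have i2 := ae_integrable _ hkm _ hLm (ne_top_of_le_ne_top h2 (b2.trans hle))
  refine le_trans ?_ (b2.trans hle)
  apply lintegral_mono_ae
  filter_upwards [i0, i1, i2] with z j0 j1 j2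
  refine le_trans (le_of_eq ?_) (enorm_integral_le_lintegral_enorm _)
  congr 1
  have := integral_bilinear_hasLineDerivAt_right_eq_neg_left_of_integrable (μ := volume)
    (f := fun y => heatKernel2 s (x' - y)) (f' := fun y => -heatKernel2Deriv i s (x' - y))
    (g := fun y => f y z) (g' := fun y => L y z v) (v := v) (B := ContinuousLinearMap.mul ℝ ℝ)
    (by simpa using j1.neg) (by simpa using j2) (by simpa using j0)
    (fun y _ => hk2_hasDeriv hs i x' y) (fun y _ => (hL y z).hasLineDerivAt v)
  simp only [ContinuousLinearMap.mul_apply', neg_mul, integral_neg, neg_neg] at this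
  exact this.symm

lemma time_int1 {α μ : ℝ} (h1 : α < 1) (hμ : 0 < μ) :
    ∫⁻ s in Set.Ioi μ, ENNReal.ofReal (s ^ (α / 2 - 1)) * ENNReal.ofReal (2 * s ^ (-(1/2) : ℝ)) =
      ENNReal.ofReal (4 / (1 - α) * μ ^ ((α - 1) / 2)) := by
  have hi := (integrableOn_Ioi_rpow_of_lt (show (α - 3) / 2 < -1 by linarith) hμ).const_mul 2
  have e : ∀ s ∈ Set.Ioi μ, ENNReal.ofReal (s ^ (α / 2 - 1)) *
      ENNReal.ofReal (2 * s ^ (-(1/2) : ℝ)) = ENNReal.ofReal (2 * s ^ ((α - 3) / 2)) := by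
    intro s hs
    have hs0 : 0 < s := hμ.trans hs
    rw [← ENNReal.ofReal_mul (by positivity), mul_left_comm, ← Real.rpow_add hs0]
    ring_nf
  rw [setLIntegral_congr_fun measurableSet_Ioi e, ← ofReal_integral_eq_lintegral_ofReal hi]
  · rw [integral_const_mul, integral_Ioi_rpow_of_lt (by linarith) hμ]
    congr 1
    have : (α - 3) / 2 + 1 = (α - 1) / 2 := by ring
    rw [this]
    have h3 : α - 1 ≠ 0 := by linarith
    have h4 : 1 - α ≠ 0 := by linarith
    field_simp; ring
  · filter_upwards [ae_restrict_mem measurableSet_Ioi] with s hs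
    have hs0 : 0 < s := hμ.trans hs
    simp only [Pi.zero_apply]; positivity

lemma time_int2 {α μ : ℝ} (h0 : 0 < α) (hμ : 0 < μ) :
    ∫⁻ s in Set.Ioc 0 μ, ENNReal.ofReal (s ^ (α / 2 - 1)) =
      ENNReal.ofReal (2 / α * μ ^ (α / 2)) := by
  have hi := intervalIntegral.intervalIntegrable_rpow' (a := 0) (b := μ)
    (show -1 < α / 2 - 1 by linarith)
  rw [intervalIntegrable_iff_integrableOn_Ioc_of_le hμ.le] at hi
  rw [← ofReal_integral_eq_lintegral_ofReal hi, ← intervalIntegral.integral_of_le hμ.le,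
    integral_rpow (Or.inl (by linarith))]
  · congr 1
    rw [sub_add_cancel, Real.zero_rpow (by positivity)]
    field_simp; ring
  · filter_upwards [ae_restrict_mem measurableSet_Ioc] with s hs
    have hs0 : 0 < s := hs.1
    simp only [Pi.zero_apply]; positivity

lemma splitting {α z₀ z₁ : ℝ} (h0 : 0 < α) (hα1 : α < 1)
    (f : (Fin 2 → ℝ) → ℝ → ℝ) (L : (Fin 2 → ℝ) → ℝ → ((Fin 2 → ℝ) →L[ℝ] ℝ))
    (hf : Measurable (Function.uncurry f))
    (hL : ∀ (x' : Fin 2 → ℝ) (z : ℝ), HasFDerivAt (fun y' => f y' z) (L x' z) x')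
    (h1 : anisoNorm z₀ z₁ f ≠ ⊤) (h2 : anisoNorm z₀ z₁ (fun x' z => ‖L x' z‖) ≠ ⊤)
    {μ : ℝ} (hμ : 0 < μ) (i : Fin 2) :
    anisoNorm z₀ z₁ (gradFracLap α i f) ≤
      ENNReal.ofReal ((Real.Gamma (α / 2))⁻¹ * (4 / (1 - α)) * μ ^ ((α - 1) / 2)) *
        anisoNorm z₀ z₁ f +
      ENNReal.ofReal ((Real.Gamma (α / 2))⁻¹ * (2 / α) * μ ^ (α / 2)) *
        anisoNorm z₀ z₁ (fun x' z => ‖L x' z‖) := by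
  have hΓ : 0 < (Real.Gamma (α / 2))⁻¹ := inv_pos.2 (Real.Gamma_pos_of_pos (by positivity))
  refine essSup_le_of_ae_le _ (Filter.Eventually.of_forall fun x' => ?_)
  set A := anisoNorm z₀ z₁ f
  set B := anisoNorm z₀ z₁ (fun x' z => ‖L x' z‖)
  set T : ℝ → ℝ → ℝ := fun s z => ∫ y, heatKernel2Deriv i s (x' - y) * f y z with hT
  have hTm : Measurable (Function.uncurry T) := by
    refine StronglyMeasurable.measurable ?_
    refine StronglyMeasurable.integral_prod_right'
      (f := fun p : (ℝ × ℝ) × (Fin 2 → ℝ) =>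
        heatKernel2Deriv i p.1.1 (x' - p.2) * f p.2 p.1.2) ?_
    refine Measurable.stronglyMeasurable (Measurable.mul ?_ ?_)
    · exact (measurable_hk2Deriv i).comp
        (measurable_fst.fst.prodMk (measurable_const.sub measurable_snd))
    · exact hf.comp (measurable_snd.prodMk measurable_fst.snd)
  have hw : Measurable (fun s : ℝ => ENNReal.ofReal (s ^ (α / 2 - 1))) := by fun_prop
  calc ∫⁻ z in Set.Ioo z₀ z₁, (‖gradFracLap α i f x' z‖₊ : ℝ≥0∞)
      ≤ ∫⁻ z in Set.Ioo z₀ z₁, ENNReal.ofReal (Real.Gamma (α / 2))⁻¹ *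
          ∫⁻ s in Set.Ioi (0:ℝ), ENNReal.ofReal (s ^ (α / 2 - 1)) * ‖T s z‖ₑ := by
        apply lintegral_mono
        intro z
        change ‖gradFracLap α i f x' z‖ₑ ≤ _
        unfold gradFracLap
        rw [enorm_mul, Real.enorm_of_nonneg hΓ.le]
        refine mul_le_mul_right ?_ _
        refine (enorm_integral_le_lintegral_enorm _).trans ?_
        apply setLIntegral_mono' measurableSet_Ioi
        intro s hs
        have hs0 : 0 < s := hs
        rw [enorm_mul, Real.enorm_of_nonneg (by positivity)]
    _ = ENNReal.ofReal (Real.Gamma (α / 2))⁻¹ * ∫⁻ s in Set.Ioi (0:ℝ),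
          ENNReal.ofReal (s ^ (α / 2 - 1)) * ∫⁻ z in Set.Ioo z₀ z₁, ‖T s z‖ₑ := by
        rw [lintegral_const_mul' _ _ ENNReal.ofReal_ne_top, lintegral_lintegral_swap]
        · congr 2; ext s
          rw [lintegral_const_mul' _ _ ENNReal.ofReal_ne_top]
        · exact ((hw.comp measurable_snd).mul (hTm.comp measurable_swap).enorm).aemeasurable
    _ ≤ ENNReal.ofReal (Real.Gamma (α / 2))⁻¹ *
          (ENNReal.ofReal (4 / (1 - α) * μ ^ ((α - 1) / 2)) * A +
            ENNReal.ofReal (2 / α * μ ^ (α / 2)) * B) := by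
        gcongr
        rw [← Set.Ioc_union_Ioi_eq_Ioi hμ.le, lintegral_union measurableSet_Ioi
          (Set.Ioc_disjoint_Ioi le_rfl), add_comm]
        rw [← time_int1 hα1 hμ, ← time_int2 h0 hμ]
        have hw2 : Measurable (fun s : ℝ => ENNReal.ofReal (2 * s ^ (-(1/2) : ℝ))) := by fun_prop
        rw [← lintegral_mul_const _ (by exact hw.mul hw2), ← lintegral_mul_const _ hw]
        apply add_le_add
        · apply setLIntegral_mono' measurableSet_Ioi
          intro s hs
          have hs0 : 0 < s := hμ.trans hs
          rw [mul_assoc]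
          gcongr
          refine le_trans ?_ (slice_bound1 hs0 i x' f hf)
          exact lintegral_mono fun z => enorm_integral_le_lintegral_enorm _
        · apply setLIntegral_mono' measurableSet_Ioc
          intro s hs
          gcongr
          exact slice_bound2 hs.1 i x' f L hf hL h1 h2
    _ = _ := by
        rw [mul_add, ← mul_assoc, ← mul_assoc, ← ENNReal.ofReal_mul hΓ.le,
          ← ENNReal.ofReal_mul hΓ.le, ← mul_assoc, ← mul_assoc]

/-- Interpolation inequality for the horizontal fractional Laplacian in `L^∞(L¹)`
(Lemma 2.3): the splitting estimate for every `μ > 0` with constants depending only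
on `α`, and consequently
`‖∇_H(-Δ_H)^{-α/2} f‖_{L^∞(L¹)} ≤ C ‖f‖_{L^∞(L¹)}^α ‖∇_H f‖_{L^∞(L¹)}^{1-α}`. -/
theorem grad_frac_laplacian_interpolation (α z₀ z₁ : ℝ)
    (hα : α ∈ Set.Ioo (0:ℝ) 1) (hz : z₀ < z₁) :
    ∃ C₄ > (0:ℝ), ∃ C₅ > (0:ℝ), ∃ C > (0:ℝ),
      ∀ (f : (Fin 2 → ℝ) → ℝ → ℝ) (L : (Fin 2 → ℝ) → ℝ → ((Fin 2 → ℝ) →L[ℝ] ℝ)),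
        Measurable (Function.uncurry f) →
        (∀ (x' : Fin 2 → ℝ) (z : ℝ), HasFDerivAt (fun y' => f y' z) (L x' z) x') →
        anisoNorm z₀ z₁ f ≠ 0 → anisoNorm z₀ z₁ f ≠ ⊤ →
        anisoNorm z₀ z₁ (fun x' z => ‖L x' z‖) ≠ 0 →
        anisoNorm z₀ z₁ (fun x' z => ‖L x' z‖) ≠ ⊤ →
        (∀ μ > (0:ℝ), ∀ i : Fin 2,
          anisoNorm z₀ z₁ (gradFracLap α i f) ≤
            ENNReal.ofReal (C₄ * μ ^ ((α - 1) / 2)) * anisoNorm z₀ z₁ f +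
            ENNReal.ofReal (C₅ * μ ^ (α / 2)) *
              anisoNorm z₀ z₁ (fun x' z => ‖L x' z‖)) ∧
        (∀ i : Fin 2,
          anisoNorm z₀ z₁ (gradFracLap α i f) ≤
            ENNReal.ofReal C * (anisoNorm z₀ z₁ f) ^ α *
              (anisoNorm z₀ z₁ (fun x' z => ‖L x' z‖)) ^ (1 - α)) := by
  obtain ⟨h0, h1⟩ := hα
  have hΓ : 0 < (Real.Gamma (α / 2))⁻¹ := inv_pos.2 (Real.Gamma_pos_of_pos (by positivity))
  have h1' : 0 < 1 - α := by linarith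
  have hC4 : 0 < (Real.Gamma (α / 2))⁻¹ * (4 / (1 - α)) := by positivity
  have hC5 : 0 < (Real.Gamma (α / 2))⁻¹ * (2 / α) := by positivity
  refine ⟨_, hC4, _, hC5, _, add_pos hC4 hC5, ?_⟩
  intro f L hf hL hA0 hA hB0 hB
  refine ⟨fun μ hμ i => splitting h0 h1 f L hf hL hA hB hμ i, fun i => ?_⟩
  set A := anisoNorm z₀ z₁ f
  set B := anisoNorm z₀ z₁ (fun x' z => ‖L x' z‖)
  have ha : 0 < A.toReal := ENNReal.toReal_pos hA0 hA
  have hb : 0 < B.toReal := ENNReal.toReal_pos hB0 hB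
  have hμ : 0 < (A.toReal / B.toReal) ^ 2 := by positivity
  refine (splitting h0 h1 f L hf hL hA hB hμ i).trans (le_of_eq ?_)
  change _ * A + _ * B = _ * A ^ α * B ^ (1 - α)
  set a := A.toReal
  set b := B.toReal
  have eA : A = ENNReal.ofReal a := (ENNReal.ofReal_toReal hA).symm
  have eB : B = ENNReal.ofReal b := (ENNReal.ofReal_toReal hB).symm
  rw [eA, eB, ENNReal.ofReal_rpow_of_pos ha, ENNReal.ofReal_rpow_of_pos hb,
    ← ENNReal.ofReal_mul (by positivity), ← ENNReal.ofReal_mul (by positivity),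
    ← ENNReal.ofReal_mul (by positivity), ← ENNReal.ofReal_mul (by positivity),
    ← ENNReal.ofReal_add (by positivity) (by positivity)]
  congr 1
  have hq : 0 < a / b := by positivity
  have p1 : ((a / b) ^ 2) ^ ((α - 1) / 2) * a = a ^ α * b ^ (1 - α) := by
    rw [← Real.rpow_natCast, ← Real.rpow_mul hq.le,
      show ((2 : ℕ) : ℝ) * ((α - 1) / 2) = α - 1 by push_cast; ring,
      Real.div_rpow ha.le hb.le, Real.rpow_sub ha, Real.rpow_one,
      show (1 - α) = -(α - 1) by ring, Real.rpow_neg hb.le]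
    field_simp
  have p2 : ((a / b) ^ 2) ^ (α / 2) * b = a ^ α * b ^ (1 - α) := by
    rw [← Real.rpow_natCast, ← Real.rpow_mul hq.le,
      show ((2 : ℕ) : ℝ) * (α / 2) = α by push_cast; ring,
      Real.div_rpow ha.le hb.le, Real.rpow_sub hb, Real.rpow_one]
    field_simp
  rw [mul_assoc, p1, mul_assoc _ _ b, p2]
  ring
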